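/- For every α ∈ (0,1) and every integer k ≥ 1 there exist a real number b > 0 and real numbers ζ_1, d_1, …, ζ_k, d_k with 0 > ζ_1 > d_1 > ζ_2 > d_2 > ⋯ > ζ_k > d_k such that the rational function r(z) = b · ∏_{i=1}^{k} (z − ζ_i)/(z − d_i) attains the best uniform rational approximation error: sup_{z ∈ [0,1]} |r(z) − z^α| = E_{α,k}. In particular, the best uniform rational approximation of z^α on [0,1] of degree k exists, is non-degenerate, and has real, negative, interlacing zeros and poles. -/

import Mathlib

open Real Set Finset

/-- The best uniform rational approximation (BURA) error `E_{q,α,k}` of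
`g_q(z;α) = z^α/(1 + q z^α)` on `[0,1]` by rational functions `P/Q` with
`deg P, deg Q ≤ k` and `Q` nonvanishing on `[0,1]`; `E_{α,k} = E_{0,α,k}`. -/
noncomputable def buraError (q α : ℝ) (k : ℕ) : ℝ :=
  sInf { e : ℝ | ∃ P Q : Polynomial ℝ, P.natDegree ≤ k ∧ Q.natDegree ≤ k ∧
    (∀ z ∈ Set.Icc (0:ℝ) 1, Q.eval z ≠ 0) ∧
    e = ⨆ z : Set.Icc (0:ℝ) 1,
      |P.eval (z : ℝ) / Q.eval (z : ℝ) - (z : ℝ) ^ α / (1 + q * (z : ℝ) ^ α)| }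

open Polynomial MeasureTheory

theorem exists_integral_rpow_sub_one_div {α : ℝ} (hα : α ∈ Set.Ioo (0:ℝ) 1) :
    ∃ c : ℝ, 0 < c ∧ ∀ z : ℝ, 0 < z →
      IntegrableOn (fun t : ℝ => t ^ (α - 1) / (t + z)) (Set.Ioi 0) ∧
      ∫ t in Set.Ioi (0:ℝ), t ^ (α - 1) / (t + z) = c * z ^ (α - 1) := by
  refine ⟨∫ t in Set.Ioi 0, Real.rpowIntegrand₀₁ α t 1,
    Real.integral_rpowIntegrand₀₁_one_pos hα, fun z hz => ?_⟩
  have heq : Set.EqOn (fun t => Real.rpowIntegrand₀₁ α t z * z⁻¹)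
      (fun t : ℝ => t ^ (α - 1) / (t + z)) (Set.Ioi 0) := by
    intro t ht
    simp only
    rw [Real.rpowIntegrand₀₁_eq_pow_div hα (le_of_lt ht) hz.le]
    field_simp
  have hmul : IntegrableOn (fun t => Real.rpowIntegrand₀₁ α t z * z⁻¹) (Set.Ioi 0) :=
    (Real.integrableOn_rpowIntegrand₀₁_Ioi hα hz.le).mul_const z⁻¹
  refine ⟨hmul.congr_fun heq measurableSet_Ioi, ?_⟩
  rw [← setIntegral_congr_fun measurableSet_Ioi heq, integral_mul_const,
    Real.integral_rpowIntegrand₀₁_eq_rpow_mul_const hα hz.le, Real.rpow_sub_one hz.ne']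
  ring

/-- The signed barycentric functional `G ↦ (-1)^{#S+1} ∑ w_z z^{α-1} G(z)` is positive on
polynomials of degree `< #S` which are nonnegative on the negative half-line. -/
theorem sum_nodalWeight_rpow_pos {α : ℝ} (hα : α ∈ Set.Ioo (0:ℝ) 1) {S : Finset ℝ}
    (hS : ∀ z ∈ S, 0 < z) {G : ℝ[X]} (hdeg : G.natDegree < #S) (hG0 : G ≠ 0)
    (hG : ∀ x < 0, 0 ≤ G.eval x) :
    0 < (-1) ^ (#S + 1) * ∑ z ∈ S, Lagrange.nodalWeight S id z * (z ^ (α - 1) * G.eval z) := by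
  obtain ⟨c, hc, hint⟩ := exists_integral_rpow_sub_one_div hα
  have hdeg' : G.degree < #S := by
    rw [Polynomial.degree_eq_natDegree hG0]; exact_mod_cast hdeg
  have hinj : Set.InjOn (id : ℝ → ℝ) S := Set.injOn_id _
  have hw : ∀ t : ℝ, 0 < t → 0 < (-1) ^ #S * (Lagrange.nodal S id).eval (-t) := by
    intro t ht
    rw [Lagrange.eval_nodal, ← Finset.prod_const, ← Finset.prod_mul_distrib]
    exact Finset.prod_pos fun z hz => by have := hS z hz; simp only [id]; linarith
  have hpf : ∀ t : ℝ, 0 < t →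
      ∑ z ∈ S, (-1) ^ (#S + 1) * (Lagrange.nodalWeight S id z * G.eval z) *
        (t ^ (α - 1) / (t + z)) =
      t ^ (α - 1) * G.eval (-t) / ((-1) ^ #S * (Lagrange.nodal S id).eval (-t)) := by
    intro t ht
    have hne : ∀ i ∈ S, -t ≠ id i := fun i hi => by
      have := hS i hi; simp only [id]; intro h; linarith
    have h1 := Lagrange.eval_interpolate_not_at_node (s := S) (v := id)
      (fun i => G.eval (id i)) hne
    rw [← Lagrange.eq_interpolate hinj hdeg'] at h1
    have hw0 := hw t ht
    rw [h1, eq_div_iff hw0.ne', mul_comm (t ^ (α - 1)), mul_assoc _ _ (t ^ (α - 1)),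
      mul_comm _ ((-1) ^ #S * _), mul_assoc, mul_left_comm]
    congr 1
    rw [Finset.mul_sum, Finset.sum_mul]
    refine Finset.sum_congr rfl fun z hz => ?_
    have h2 : t + z ≠ 0 := by have := hS z hz; positivity
    have h3 : -t - z ≠ 0 := by intro h; apply h2; linarith
    have h4 : (-t - z)⁻¹ = - (t + z)⁻¹ := by rw [← inv_neg]; congr 1; ring
    have h5 : ((-1 : ℝ) ^ #S) * (-1) ^ #S = 1 := by rw [← mul_pow]; simp
    simp only [id, h4, pow_succ]
    linear_combination (-Lagrange.nodalWeight S id z * (t + z)⁻¹ * eval z G * t ^ (α - 1)) * h5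
  have hI : ∀ z ∈ S, IntegrableOn (fun t : ℝ => (-1) ^ (#S + 1) *
      (Lagrange.nodalWeight S id z * G.eval z) * (t ^ (α - 1) / (t + z))) (Set.Ioi 0) :=
    fun z hz => (hint z (hS z hz)).1.const_mul _
  set F : ℝ → ℝ := fun t => ∑ z ∈ S, (-1) ^ (#S + 1) *
    (Lagrange.nodalWeight S id z * G.eval z) * (t ^ (α - 1) / (t + z)) with hF
  have hFint : IntegrableOn F (Set.Ioi 0) := integrable_finsetSum _ hI
  have hsum : ∫ t in Set.Ioi (0:ℝ), F t = c * ((-1) ^ (#S + 1) *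
      ∑ z ∈ S, Lagrange.nodalWeight S id z * (z ^ (α - 1) * G.eval z)) := by
    rw [hF, integral_finsetSum _ hI, Finset.mul_sum, Finset.mul_sum]
    refine Finset.sum_congr rfl fun z hz => ?_
    rw [integral_const_mul, (hint z (hS z hz)).2]
    ring
  have hpos : 0 < ∫ t in Set.Ioi (0:ℝ), F t := by
    rw [setIntegral_pos_iff_support_of_nonneg_ae _ hFint]
    · have hsub : Set.Ioi (0:ℝ) \ ((fun x => -x) '' (G.roots.toFinset : Set ℝ)) ⊆
          Function.support F ∩ Set.Ioi 0 := by
        rintro t ⟨ht, htr⟩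
        refine ⟨?_, ht⟩
        have ht' : (0:ℝ) < t := ht
        rw [Function.mem_support, hF]
        simp only
        rw [hpf t ht]
        refine div_ne_zero (mul_ne_zero (Real.rpow_pos_of_pos ht' _).ne' ?_) (hw t ht).ne'
        intro h0
        exact htr ⟨-t, by simp [hG0, h0], by simp⟩
      refine lt_of_lt_of_le ?_ (measure_mono hsub)
      rw [measure_sdiff_null ((G.roots.toFinset.finite_toSet.image _).measure_zero _)]
      simp
    · filter_upwards [ae_restrict_mem measurableSet_Ioi] with t ht
      have ht' : (0:ℝ) < t := ht
      rw [hF]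
      simp only [Pi.zero_apply]
      rw [hpf t ht]
      exact div_nonneg (mul_nonneg (Real.rpow_pos_of_pos ht' _).le (hG _ (by linarith)))
        (hw t ht).le
  rw [hsum] at hpos
  exact pos_of_mul_pos_right hpos hc.le

theorem sum_nodalWeight_eval_eq_zero {S : Finset ℝ} {H : ℝ[X]} (hdeg : H.natDegree + 2 ≤ #S) :
    ∑ z ∈ S, Lagrange.nodalWeight S id z * H.eval z = 0 := by
  have h := Lagrange.coeff_eq_sum (s := S) (v := (id : ℝ → ℝ)) (Set.injOn_id _) (P := H)
    (lt_of_le_of_lt Polynomial.degree_le_natDegree (by exact_mod_cast (by omega)))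
  rw [Polynomial.coeff_eq_zero_of_natDegree_lt (by omega)] at h
  rw [h]
  refine Finset.sum_congr rfl fun z hz => ?_
  rw [Lagrange.nodalWeight, Finset.prod_inv_distrib, div_eq_mul_inv, mul_comm]
  rfl

/-- If `p = z^α q` at the points of `S`, then `q r` cannot be nonnegative on the negative
half-line when the degrees are small compared with `#S`. -/
theorem not_forall_nonneg_mul_of_interpolates {α : ℝ} (hα : α ∈ Set.Ioo (0:ℝ) 1)
    {S : Finset ℝ} (hS : ∀ z ∈ S, 0 < z) {p q r : ℝ[X]}
    (hpq : ∀ z ∈ S, p.eval z = z ^ α * q.eval z) (h1 : (p * r).natDegree + 2 ≤ #S)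
    (h2 : (q * r).natDegree + 2 ≤ #S) (h0 : q * r ≠ 0) :
    ¬ ∀ x < 0, 0 ≤ (q * r).eval x := by
  intro hnn
  have hpos := sum_nodalWeight_rpow_pos hα hS (G := -(X * (q * r)))
    (by rw [natDegree_neg]; exact lt_of_le_of_lt natDegree_mul_le (by rw [natDegree_X]; omega))
    (neg_ne_zero.2 (mul_ne_zero X_ne_zero h0))
    (fun x hx => by
      have := hnn x hx
      simp only [eval_neg, eval_mul, eval_X] at this ⊢
      nlinarith)
  have hz := sum_nodalWeight_eval_eq_zero h1
  have hsum : ∑ z ∈ S, Lagrange.nodalWeight S id z *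
      (z ^ (α - 1) * (-(X * (q * r))).eval z) =
      -∑ z ∈ S, Lagrange.nodalWeight S id z * (p * r).eval z := by
    rw [← Finset.sum_neg_distrib]
    refine Finset.sum_congr rfl fun z hz => ?_
    have hz0 := hS z hz
    rw [Real.rpow_sub_one hz0.ne']
    simp only [eval_neg, eval_mul, eval_X, hpq z hz]
    field_simp
  rw [hsum, hz] at hpos
  simp at hpos

theorem card_le_of_interpolates {α : ℝ} (hα : α ∈ Set.Ioo (0:ℝ) 1)
    {S : Finset ℝ} (hS : ∀ z ∈ S, 0 < z) {p q : ℝ[X]} {n : ℕ}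
    (hpq : ∀ z ∈ S, p.eval z = z ^ α * q.eval z) (hp : p.natDegree ≤ n)
    (hq : q.natDegree ≤ n) (hq0 : q ≠ 0) : #S ≤ 2 * n + 1 := by
  by_contra! hlt
  have hpq' : (p * q).natDegree ≤ n + n := natDegree_mul_le_of_le hp hq
  have hqq' : (q * q).natDegree ≤ n + n := natDegree_mul_le_of_le hq hq
  refine not_forall_nonneg_mul_of_interpolates hα hS hpq (r := q) (by omega) (by omega)
    (mul_ne_zero hq0 hq0) fun x _ => ?_
  rw [eval_mul]
  exact mul_self_nonneg _

section Interpolation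

variable {α : ℝ} {S : Finset ℝ} {p q : ℝ[X]} {k : ℕ}

theorem eval_nodal_neg_of_card_odd (hS : ∀ z ∈ S, 0 < z) (hcard : #S = 2 * k + 1) {x : ℝ}
    (hx : x ≤ 0) : (Lagrange.nodal S id).eval x < 0 := by
  have h : 0 < ∏ z ∈ S, (z - x) := Finset.prod_pos fun z hz => by have := hS z hz; linarith
  have h2 : (Lagrange.nodal S id).eval x = -∏ z ∈ S, (z - x) := by
    rw [Lagrange.eval_nodal]
    have : ∀ z ∈ S, x - id z = (-1) * (z - x) := fun z _ => by simp
    rw [Finset.prod_congr rfl this, Finset.prod_mul_distrib, Finset.prod_const, hcard]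
    simp [pow_succ, pow_mul]
  linarith

theorem eval_eq_nodal_mul_sum (hS : ∀ z ∈ S, 0 < z) {x : ℝ} (hx : x ≤ 0) {H : ℝ[X]}
    (hH : H.natDegree < #S) :
    H.eval x = (Lagrange.nodal S id).eval x *
      ∑ z ∈ S, Lagrange.nodalWeight S id z * (x - z)⁻¹ * H.eval z := by
  have hne : ∀ i ∈ S, x ≠ id i := fun i hi => by
    have := hS i hi; simp only [id]; intro h; linarith
  have h1 := Lagrange.eval_interpolate_not_at_node (s := S) (v := id)
    (fun i => H.eval (id i)) hne
  rw [← Lagrange.eq_interpolate (Set.injOn_id _)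
    (lt_of_le_of_lt Polynomial.degree_le_natDegree (by exact_mod_cast hH))] at h1
  exact h1

theorem natDegree_eq_of_interpolates (hα : α ∈ Set.Ioo (0:ℝ) 1) (hS : ∀ z ∈ S, 0 < z)
    (hcard : #S = 2 * k + 1) (hpq : ∀ z ∈ S, p.eval z = z ^ α * q.eval z)
    (hp : p.natDegree ≤ k) (hq : q.natDegree ≤ k) (hq0 : q ≠ 0) : q.natDegree = k := by
  by_contra hne
  have hlt : q.natDegree < k := lt_of_le_of_ne hq hne
  have hpq' : (p * q).natDegree ≤ k + q.natDegree := natDegree_mul_le_of_le hp le_rfl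
  have hqq' : (q * q).natDegree ≤ k + q.natDegree := natDegree_mul_le_of_le hq le_rfl
  refine not_forall_nonneg_mul_of_interpolates hα hS hpq (r := q) (by omega) (by omega)
    (mul_ne_zero hq0 hq0) fun x _ => ?_
  rw [eval_mul]
  exact mul_self_nonneg _

theorem constant_sign_of_no_root {g : ℝ[X]} (h : ∀ x, g.eval x ≠ 0) :
    (∀ x, 0 < g.eval x) ∨ ∀ x, g.eval x < 0 := by
  by_contra! hcon
  obtain ⟨⟨x, hx⟩, y, hy⟩ := hcon
  obtain ⟨z, hz⟩ := mem_range_of_exists_le_of_exists_ge g.continuous ⟨x, hx⟩ ⟨y, hy⟩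
  exact h z hz

theorem splits_of_interpolates (hα : α ∈ Set.Ioo (0:ℝ) 1) (hS : ∀ z ∈ S, 0 < z)
    (hcard : #S = 2 * k + 1) (hpq : ∀ z ∈ S, p.eval z = z ^ α * q.eval z)
    (hp : p.natDegree ≤ k) (hq : q.natDegree ≤ k) (hq0 : q ≠ 0) : q.Splits := by
  have hirr : ∀ g : ℝ[X], Irreducible g → g ∣ q → g.natDegree = 1 := by
    rintro g hg ⟨h, rfl⟩
    by_contra hne
    have h2 : g.natDegree = 2 := by
      have h3 : g.natDegree ≤ 2 := natDegree_le_of_degree_le hg.degree_le_two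
      have h4 := hg.natDegree_pos
      omega
    have hroot : ∀ x, g.eval x ≠ 0 := fun x hx =>
      hne (natDegree_eq_of_degree_eq_some (degree_eq_one_of_irreducible_of_root hg hx))
    have hh0 : h ≠ 0 := right_ne_zero_of_mul hq0
    rw [natDegree_mul hg.ne_zero hh0] at hq
    have hd1 : (p * h).natDegree ≤ k + h.natDegree := natDegree_mul_le_of_le hp le_rfl
    have hd2 : (g * h * h).natDegree ≤ k + h.natDegree :=
      natDegree_mul_le_of_le (by rw [natDegree_mul hg.ne_zero hh0]; exact hq) le_rfl
    rcases constant_sign_of_no_root hroot with hs | hs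
    · refine not_forall_nonneg_mul_of_interpolates hα hS hpq (r := h) (by omega) (by omega)
        (mul_ne_zero hq0 hh0) fun x _ => ?_
      rw [eval_mul, eval_mul, mul_assoc]
      exact mul_nonneg (hs x).le (mul_self_nonneg _)
    · refine not_forall_nonneg_mul_of_interpolates hα hS hpq (r := -h)
        (by rw [mul_neg, natDegree_neg]; omega) (by rw [mul_neg, natDegree_neg]; omega)
        (mul_ne_zero hq0 (neg_ne_zero.2 hh0)) fun x _ => ?_
      rw [eval_mul, eval_mul, eval_neg]
      nlinarith [hs x, mul_self_nonneg (eval x h)]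
  obtain ⟨u, hu⟩ := UniqueFactorizationMonoid.factors_prod hq0
  rw [← hu]
  refine (Splits.multisetProd fun g hg ↦ ?_).mul u.isUnit.splits
  exact Splits.of_natDegree_eq_one (hirr g
    (UniqueFactorizationMonoid.irreducible_of_factor g hg)
    (UniqueFactorizationMonoid.dvd_of_mem_factors hg))

theorem root_neg_of_interpolates (hα : α ∈ Set.Ioo (0:ℝ) 1) (hS : ∀ z ∈ S, 0 < z)
    (hcard : #S = 2 * k + 1) (hpq : ∀ z ∈ S, p.eval z = z ^ α * q.eval z)
    (hp : p.natDegree ≤ k) (hq : q.natDegree ≤ k) (hq0 : q ≠ 0) {d : ℝ} (hd : q.IsRoot d) :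
    d < 0 := by
  by_contra! hd0
  obtain ⟨h, rfl⟩ := dvd_iff_isRoot.2 hd
  have hh0 : h ≠ 0 := right_ne_zero_of_mul hq0
  have hq' := hq
  rw [natDegree_mul (X_sub_C_ne_zero d) hh0, natDegree_X_sub_C] at hq'
  have hd1 : (p * h).natDegree ≤ k + h.natDegree := natDegree_mul_le_of_le hp le_rfl
  have hd2 : ((X - C d) * h * h).natDegree ≤ k + h.natDegree := natDegree_mul_le_of_le hq le_rfl
  refine not_forall_nonneg_mul_of_interpolates hα hS hpq (r := -h)
    (by rw [mul_neg, natDegree_neg]; omega) (by rw [mul_neg, natDegree_neg]; omega)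
    (mul_ne_zero hq0 (neg_ne_zero.2 hh0)) fun x hx => ?_
  rw [eval_mul, eval_mul, eval_neg, eval_sub, eval_X, eval_C]
  nlinarith [mul_self_nonneg (eval x h)]

theorem eval_mul_eval_neg_of_interpolates (hα : α ∈ Set.Ioo (0:ℝ) 1) (hS : ∀ z ∈ S, 0 < z)
    (hcard : #S = 2 * k + 1) {d : ℝ} {h : ℝ[X]}
    (hpq : ∀ z ∈ S, p.eval z = z ^ α * ((X - C d) * h).eval z)
    (hp : p.natDegree ≤ k) (hh : h.natDegree + 1 ≤ k) (hh0 : h ≠ 0) (hd : d < 0) :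
    p.eval d * h.eval d < 0 := by
  have hd1 : (p * h).natDegree ≤ k + h.natDegree := natDegree_mul_le_of_le hp le_rfl
  have hd2 : (h * h).natDegree ≤ h.natDegree + h.natDegree := natDegree_mul_le
  have heq := eval_eq_nodal_mul_sum hS hd.le (H := p * h) (by omega)
  have hw := eval_nodal_neg_of_card_odd hS hcard hd.le
  have hpos := sum_nodalWeight_rpow_pos hα hS (G := -(X * (h * h)))
    (by rw [natDegree_neg]; exact lt_of_le_of_lt natDegree_mul_le (by rw [natDegree_X]; omega))
    (neg_ne_zero.2 (mul_ne_zero X_ne_zero (mul_ne_zero hh0 hh0)))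
    (fun x hx => by
      simp only [eval_neg, eval_mul, eval_X]
      nlinarith [mul_self_nonneg (eval x h)])
  have hsgn : ((-1 : ℝ)) ^ (#S + 1) = 1 := Even.neg_one_pow ⟨k + 1, by omega⟩
  rw [hsgn, one_mul] at hpos
  rw [eval_mul] at heq
  rw [heq]
  refine mul_neg_of_neg_of_pos hw (lt_of_lt_of_eq hpos (Finset.sum_congr rfl fun z hz => ?_))
  have hz0 := hS z hz
  have hdz : d - z ≠ 0 := by intro h; linarith
  have hinv : (d - z)⁻¹ * (z - d) = -1 := by rw [← neg_sub d z, mul_neg, inv_mul_cancel₀ hdz]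
  rw [Real.rpow_sub_one hz0.ne']
  simp only [eval_neg, eval_mul, eval_X, hpq z hz, eval_sub, eval_C]
  have hzz : z ^ α / z * (z * (eval z h * eval z h)) = z ^ α * (eval z h * eval z h) := by
    field_simp
  linear_combination (-Lagrange.nodalWeight S id z) * hzz -
    (Lagrange.nodalWeight S id z * z ^ α * eval z h * eval z h) * hinv

theorem eval_zero_mul_eval_zero_pos_of_interpolates (hα : α ∈ Set.Ioo (0:ℝ) 1)
    (hS : ∀ z ∈ S, 0 < z) (hcard : #S = 2 * k + 1)
    (hpq : ∀ z ∈ S, p.eval z = z ^ α * q.eval z)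
    (hp : p.natDegree ≤ k) (hq : q.natDegree ≤ k) (hq0 : q ≠ 0) :
    0 < p.eval 0 * q.eval 0 := by
  have hd1 : (p * q).natDegree ≤ k + k := natDegree_mul_le_of_le hp hq
  have hd2 : (q * q).natDegree ≤ k + k := natDegree_mul_le_of_le hq hq
  have heq := eval_eq_nodal_mul_sum hS le_rfl (H := p * q) (by omega)
  have hw := eval_nodal_neg_of_card_odd hS hcard le_rfl
  have hpos := sum_nodalWeight_rpow_pos hα hS (G := q * q) (by omega) (mul_ne_zero hq0 hq0)
    (fun x hx => by rw [eval_mul]; exact mul_self_nonneg _)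
  have hsgn : ((-1 : ℝ)) ^ (#S + 1) = 1 := Even.neg_one_pow ⟨k + 1, by omega⟩
  rw [hsgn, one_mul] at hpos
  rw [eval_mul] at heq
  rw [heq]
  refine mul_pos_of_neg_of_neg hw (neg_pos.1 (lt_of_lt_of_eq hpos ?_))
  rw [← Finset.sum_neg_distrib]
  refine Finset.sum_congr rfl fun z hz => ?_
  have hz0 := hS z hz
  rw [Real.rpow_sub_one hz0.ne', zero_sub, inv_neg]
  simp only [eval_mul, hpq z hz]
  field_simp

end Interpolation

theorem eq_C_mul_prod_X_sub_C_of_roots {k : ℕ} {p : ℝ[X]} (hp : p.natDegree ≤ k) {f : Fin k → ℝ}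
    (hf : Function.Injective f) (h0 : ∀ i, f i ≠ 0) (hr : ∀ i, p.eval (f i) = 0) :
    p = C (p.eval 0 / ∏ i, (0 - f i)) * ∏ i, (X - C (f i)) := by
  have hinj : Function.Injective (Fin.cons 0 f : Fin (k + 1) → ℝ) := by
    rw [Fin.cons_injective_iff]
    exact ⟨fun ⟨i, hi⟩ => h0 i hi, hf⟩
  refine Polynomial.eq_of_natDegree_lt_card_of_eval_eq _ _ hinj ?_ ?_
  · intro i
    refine Fin.cases ?_ (fun j => ?_) i
    · have hprod : ∏ i, (0 - f i) ≠ 0 :=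
        Finset.prod_ne_zero_iff.2 fun i _ => by simpa using h0 i
      simp only [Fin.cons_zero, eval_mul, eval_C, eval_prod, eval_sub, eval_X]
      rw [div_mul_cancel₀ _ hprod]
    · simp only [Fin.cons_succ, hr j, eval_mul, eval_C, eval_prod, eval_sub, eval_X]
      rw [Finset.prod_eq_zero (f := fun i => f j - f i) (Finset.mem_univ j) (sub_self _), mul_zero]
  · rw [Fintype.card_fin, max_lt_iff]
    refine ⟨by omega, Nat.lt_succ_of_le (natDegree_C_mul_le _ _ |>.trans ?_)⟩
    rw [natDegree_prod_of_monic _ _ fun i _ => monic_X_sub_C _]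
    simp

theorem neg_one_pow_mul_prod_erase_pos {k : ℕ} {d : Fin k → ℝ} (hd : StrictAnti d) (i : Fin k) :
    0 < (-1 : ℝ) ^ (i : ℕ) * ∏ j ∈ Finset.univ.erase i, (d i - d j) := by
  have h1 : ((-1 : ℝ)) ^ (i : ℕ) =
      ∏ j ∈ Finset.univ.erase i, (if j < i then (-1 : ℝ) else 1) := by
    rw [Finset.prod_ite, Finset.prod_const, Finset.prod_const_one, mul_one]
    congr 1
    have : (Finset.univ.erase i).filter (· < i) = Finset.Iio i := by
      ext j
      simp only [Finset.mem_filter, Finset.mem_erase, Finset.mem_univ, Finset.mem_Iio, and_true]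
      exact ⟨fun h => h.2, fun h => ⟨h.ne, h⟩⟩
    rw [this, Fin.card_Iio]
  rw [h1, ← Finset.prod_mul_distrib]
  refine Finset.prod_pos fun j hj => ?_
  split_ifs with hji
  · have := hd hji; linarith
  · have := hd (lt_of_le_of_ne (not_lt.1 hji) (Finset.ne_of_mem_erase hj).symm)
    linarith

/-- A rational function of degree `k` interpolating `z^α` at `2k+1` positive points has simple
negative interlacing zeros and poles. -/
theorem exists_interlacing_of_interpolates {α : ℝ} (hα : α ∈ Set.Ioo (0:ℝ) 1) {k : ℕ}
    (hk : 1 ≤ k) {S : Finset ℝ} (hS : ∀ z ∈ S, 0 < z) (hcard : #S = 2 * k + 1) {p q : ℝ[X]}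
    (hpq : ∀ z ∈ S, p.eval z = z ^ α * q.eval z) (hp : p.natDegree ≤ k) (hq : q.natDegree ≤ k)
    (hq0 : q ≠ 0) :
    ∃ (b : ℝ) (ζ d : Fin k → ℝ), 0 < b ∧
      ζ ⟨0, hk⟩ < 0 ∧
      (∀ i : Fin k, d i < ζ i) ∧
      (∀ i j : Fin k, (i : ℕ) + 1 = (j : ℕ) → ζ j < d i) ∧
      ∀ z : ℝ, b * ∏ i, (z - ζ i) / (z - d i) = p.eval z / q.eval z := by
  have hdegq := natDegree_eq_of_interpolates hα hS hcard hpq hp hq hq0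
  have hsplit := splits_of_interpolates hα hS hcard hpq hp hq hq0
  have hneg : ∀ d, q.eval d = 0 → d < 0 := fun d hd =>
    root_neg_of_interpolates hα hS hcard hpq hp hq hq0 hd
  have hsign : ∀ (d : ℝ) (h : ℝ[X]), q = (X - C d) * h → p.eval d * h.eval d < 0 := by
    intro d h hqh
    have hh0 : h ≠ 0 := by rintro rfl; simp [hqh] at hq0
    refine eval_mul_eval_neg_of_interpolates hα hS hcard (by rw [← hqh]; exact hpq) hp ?_ hh0
      (hneg d (by simp [hqh]))
    rw [hqh, natDegree_mul (X_sub_C_ne_zero d) hh0, natDegree_X_sub_C] at hq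
    omega
  have hzero := eval_zero_mul_eval_zero_pos_of_interpolates hα hS hcard hpq hp hq hq0
  have hnodup : q.roots.Nodup := by
    rw [Multiset.nodup_iff_count_le_one]
    intro d
    rw [count_roots]
    by_contra! hlt
    obtain ⟨h, hh⟩ := (le_rootMultiplicity_iff hq0).1 (show 2 ≤ q.rootMultiplicity d from hlt)
    have := hsign d ((X - C d) * h) (by rw [hh]; ring)
    simp at this
  have hrcard : #q.roots.toFinset = k := by
    rw [Multiset.toFinset_card_of_nodup hnodup, ← hsplit.natDegree_eq_card_roots, hdegq]
  set d : Fin k → ℝ := fun i => q.roots.toFinset.orderEmbOfFin hrcard (Fin.rev i) with hd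
  have hanti : StrictAnti d := fun i j hij =>
    (q.roots.toFinset.orderEmbOfFin hrcard).strictMono (Fin.rev_lt_rev.2 hij)
  have hroot : ∀ i, q.eval (d i) = 0 := fun i => by
    have := q.roots.toFinset.orderEmbOfFin_mem hrcard (Fin.rev i)
    rw [Multiset.mem_toFinset, mem_roots hq0] at this
    exact this
  have hd0 : ∀ i, d i < 0 := fun i => hneg _ (hroot i)
  have hqprod := eq_C_mul_prod_X_sub_C_of_roots hq hanti.injective (fun i => (hd0 i).ne) hroot
  set a : ℝ := q.eval 0 / ∏ i, (0 - d i) with ha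
  have hdprod : 0 < ∏ i, (0 - d i) := Finset.prod_pos fun i _ => by linarith [hd0 i]
  have haq : 0 < a * q.eval 0 := by
    rw [ha, div_mul_eq_mul_div]
    refine div_pos (mul_self_pos.2 fun h => ?_) hdprod
    rw [h] at hzero
    simp at hzero
  have hP : ∀ i : Fin k, (-1 : ℝ) ^ (i : ℕ) * (a * p.eval (d i)) < 0 := by
    intro i
    have h1 := hsign (d i) (C a * ∏ j ∈ Finset.univ.erase i, (X - C (d j))) (by
      rw [mul_left_comm, Finset.mul_prod_erase Finset.univ (fun j => X - C (d j))
        (Finset.mem_univ i)]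
      exact hqprod)
    simp only [eval_mul, eval_C, eval_prod, eval_sub, eval_X] at h1
    have h2 := neg_one_pow_mul_prod_erase_pos hanti i
    rcases neg_one_pow_eq_or ℝ (i : ℕ) with h | h <;> rw [h] at h2 ⊢ <;> nlinarith
  have hP0 : 0 < a * p.eval 0 := by
    by_contra! hle
    nlinarith [mul_pos haq hzero, mul_self_nonneg (q.eval 0)]
  have hex : ∀ i : Fin k, ∃ ζ, d i < ζ ∧ p.eval ζ = 0 ∧ ζ < 0 ∧
      ∀ j : Fin k, (j : ℕ) + 1 = i → ζ < d j := by
    intro i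
    have ha0 : a ≠ 0 := left_ne_zero_of_mul haq.ne'
    have key : ∀ e, d i < e → 0 ≤ (-1 : ℝ) ^ (i : ℕ) * (a * p.eval e) →
        (-1 : ℝ) ^ (i : ℕ) * (a * p.eval e) ≠ 0 →
        ∃ ζ, d i < ζ ∧ p.eval ζ = 0 ∧ ζ < e := by
      intro e hde he he'
      have hcont : ContinuousOn (fun x => (-1 : ℝ) ^ (i : ℕ) * (a * p.eval x)) (Set.Icc (d i) e) :=
        (continuous_const.mul (continuous_const.mul p.continuous)).continuousOn
      obtain ⟨ζ, hζ, hζ0⟩ := intermediate_value_Ioo hde.le hcont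
        ⟨hP i, lt_of_le_of_ne he he'.symm⟩
      refine ⟨ζ, hζ.1, ?_, hζ.2⟩
      simpa [ha0] using hζ0
    by_cases hi : (i : ℕ) = 0
    · obtain ⟨ζ, h1, h2, h3⟩ := key 0 (hd0 i) (by simp [hi, hP0.le]) (by simp [hi, hP0.ne'])
      exact ⟨ζ, h1, h2, h3, fun j hj => by omega⟩
    · obtain ⟨m, hm⟩ := Nat.exists_eq_succ_of_ne_zero hi
      have hmk : m < k := by have := i.2; omega
      have hlt := hP ⟨m, hmk⟩
      simp only at hlt
      obtain ⟨ζ, h1, h2, h3⟩ := key (d ⟨m, hmk⟩)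
        (hanti (by rw [Fin.lt_def]; simp only; omega))
        (by rw [hm, Nat.succ_eq_add_one, pow_succ]; linarith)
        (by rw [hm, Nat.succ_eq_add_one, pow_succ]; intro h; linarith)
      refine ⟨ζ, h1, h2, h3.trans (hd0 _), fun j hj => ?_⟩
      have : j = ⟨m, hmk⟩ := Fin.ext (by simp only; omega)
      rw [this]
      exact h3
  choose ζ hζ1 hζ2 hζ3 hζ4 using hex
  have hζanti : StrictAnti ζ := by
    intro i j hij
    have hjk := j.2
    have hij' := Fin.lt_def.1 hij
    have h1 := hζ4 j ⟨(j : ℕ) - 1, by omega⟩ (by simp only; omega)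
    have h2 : d ⟨(j : ℕ) - 1, by omega⟩ ≤ d i :=
      hanti.antitone (by rw [Fin.le_def]; simp only; omega)
    exact h1.trans_le (h2.trans (hζ1 i).le)
  have hpprod := eq_C_mul_prod_X_sub_C_of_roots hp hζanti.injective (fun i => (hζ3 i).ne) hζ2
  set b : ℝ := p.eval 0 / ∏ i, (0 - ζ i) with hb
  have hζprod : 0 < ∏ i, (0 - ζ i) := Finset.prod_pos fun i _ => by linarith [hζ3 i]
  refine ⟨b / a, ζ, d, ?_, hζ3 _, hζ1, fun i j hij => hζ4 j i hij, fun z => ?_⟩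
  · have hab : 0 < a * b := by rw [hb, mul_div_assoc']; exact div_pos hP0 hζprod
    have ha2 : 0 < a * a := mul_self_pos.2 (left_ne_zero_of_mul haq.ne')
    have : b / a = a * b / (a * a) := by
      rw [mul_div_mul_left _ _ (left_ne_zero_of_mul haq.ne')]
    rw [this]
    exact div_pos hab ha2
  · conv_rhs => rw [hpprod, hqprod]
    simp only [eval_mul, eval_C, eval_prod, eval_sub, eval_X]
    rw [Finset.prod_div_distrib, div_mul_div_comm]

theorem exists_bezout_natDegree_le {a b s : ℝ[X]} {n k : ℕ} (hab : IsCoprime a b) (ha0 : a ≠ 0)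
    (ha : a.natDegree = n) (hb : b.natDegree ≤ n) (hnk : n ≤ k) (hs : s.natDegree ≤ n + k) :
    ∃ u v : ℝ[X], u.natDegree ≤ k ∧ v.natDegree ≤ k ∧ u * a + v * b = s := by
  obtain ⟨u₀, v₀, huv⟩ := hab
  have hdiv := EuclideanDomain.div_add_mod (s * v₀) a
  have hv : ((s * v₀) % a).natDegree ≤ n := by
    rw [← ha]
    exact natDegree_le_natDegree (EuclideanDomain.mod_lt (s * v₀) ha0).le
  have heq : (s * u₀ + (s * v₀ / a) * b) * a + ((s * v₀) % a) * b = s := by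
    linear_combination s * huv + b * hdiv
  refine ⟨s * u₀ + (s * v₀ / a) * b, (s * v₀) % a, ?_, hv.trans hnk, heq⟩
  set u := s * u₀ + (s * v₀ / a) * b
  set v := (s * v₀) % a
  by_cases hu0 : u = 0
  · simp [hu0]
  have h1 : (u * a).natDegree ≤ n + k := by
    rw [eq_sub_of_add_eq heq]
    refine natDegree_sub_le_of_le hs ?_ |>.trans (max_self _).le
    exact (natDegree_mul_le_of_le hv hb).trans (by omega)
  rw [natDegree_mul hu0 ha0, ha] at h1
  omega

theorem exists_bezout_natDegree_le_of_max {p q s : ℝ[X]} {k : ℕ} (hpq : IsCoprime p q)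
    (hq0 : q ≠ 0) (hp : p.natDegree ≤ k) (hq : q.natDegree ≤ k)
    (hs : s.natDegree ≤ max p.natDegree q.natDegree + k) :
    ∃ u v : ℝ[X], u.natDegree ≤ k ∧ v.natDegree ≤ k ∧ u * q + v * p = s := by
  rcases le_or_gt p.natDegree q.natDegree with h | h
  · rw [max_eq_right h] at hs
    exact exists_bezout_natDegree_le hpq.symm hq0 rfl h hq hs
  · rw [max_eq_left h.le] at hs
    have hp0 : p ≠ 0 := by rintro rfl; simp at h
    obtain ⟨u, v, hu, hv, huv⟩ := exists_bezout_natDegree_le hpq hp0 rfl h.le hp hs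
    exact ⟨v, u, hv, hu, by rw [add_comm]; exact huv⟩

/-- A continuous function with finitely many zeros has the sign of a polynomial whose roots
are among these zeros. -/
theorem exists_subset_zeros_mul_prod_nonneg {e : ℝ → ℝ} (Z : Finset ℝ) :
    ∀ b : ℝ, ContinuousOn e (Set.Icc 0 b) → (∀ z ∈ Z, 0 < z ∧ z < b) →
      (∀ x, 0 < x → x < b → e x = 0 → x ∈ Z) → (∀ z ∈ Z, e z = 0) →
      ∃ S ⊆ Z, ∃ σ : ℝ, σ ≠ 0 ∧
        ∀ x, 0 < x → x < b → 0 ≤ e x * (σ * ∏ s ∈ S, (x - s)) := by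
  have hconst : ∀ a b : ℝ, 0 ≤ a → ContinuousOn e (Set.Icc 0 b) →
      (∀ x, a < x → x < b → e x ≠ 0) →
      (∀ x, a < x → x < b → 0 ≤ e x) ∨ (∀ x, a < x → x < b → e x ≤ 0) := by
    intro a b ha he hne
    by_contra! hcon
    obtain ⟨⟨x, hx1, hx2, hx⟩, y, hy1, hy2, hy⟩ := hcon
    have hsub : Set.Ioo a b ⊆ Set.Icc 0 b := fun z hz => ⟨ha.trans hz.1.le, hz.2.le⟩
    obtain ⟨z, hz, hz0⟩ := isPreconnected_Ioo.intermediate_value (a := x) (b := y)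
      ⟨hx1, hx2⟩ ⟨hy1, hy2⟩ (he.mono hsub) ⟨hx.le, hy.le⟩
    exact hne z hz.1 hz.2 hz0
  induction Z using Finset.induction_on_max with
  | empty =>
    intro b he _ hne _
    rcases hconst 0 b le_rfl he (fun x h1 h2 h3 => by simpa using hne x h1 h2 h3) with h | h
    · exact ⟨∅, subset_rfl, 1, one_ne_zero, fun x h1 h2 => by simpa using h x h1 h2⟩
    · exact ⟨∅, subset_rfl, -1, by norm_num, fun x h1 h2 => by simpa using h x h1 h2⟩
  | insert a Z hmax ih =>
    intro b he hmem hne hzero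
    obtain ⟨ha0, hab⟩ := hmem a (Finset.mem_insert_self _ _)
    have hea : e a = 0 := hzero a (Finset.mem_insert_self _ _)
    obtain ⟨S, hSZ, σ, hσ, hsgn⟩ := ih a (he.mono (Set.Icc_subset_Icc_right hab.le))
      (fun z hz => ⟨(hmem z (Finset.mem_insert_of_mem hz)).1, hmax z hz⟩)
      (fun x h1 h2 h3 =>
        (Finset.mem_insert.1 (hne x h1 (h2.trans hab) h3)).resolve_left h2.ne)
      (fun z hz => hzero z (Finset.mem_insert_of_mem hz))
    have haS : a ∉ S := fun h => (hmax a (hSZ h)).false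
    have hprod : ∀ x, a < x → 0 < ∏ s ∈ S, (x - s) := fun x hx =>
      Finset.prod_pos fun s hs => by have := hmax s (hSZ hs); linarith
    have hright := hconst a b ha0.le he (fun x h1 h2 h3 => by
      rcases Finset.mem_insert.1 (hne x (ha0.trans h1) h2 h3) with h | h
      · exact h1.ne' h
      · exact (hmax x h).not_gt h1)
    have hcase : (∀ x, a < x → x < b → 0 ≤ σ * e x) ∨ (∀ x, a < x → x < b → σ * e x ≤ 0) := by
      rcases hright with h | h <;> rcases hσ.lt_or_gt with h' | h'
      · exact Or.inr fun x h1 h2 => mul_nonpos_of_nonpos_of_nonneg h'.le (h x h1 h2)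
      · exact Or.inl fun x h1 h2 => mul_nonneg h'.le (h x h1 h2)
      · exact Or.inl fun x h1 h2 => mul_nonneg_of_nonpos_of_nonpos h'.le (h x h1 h2)
      · exact Or.inr fun x h1 h2 => mul_nonpos_of_nonneg_of_nonpos h'.le (h x h1 h2)
    rcases hcase with h | h
    · refine ⟨S, hSZ.trans (Finset.subset_insert _ _), σ, hσ, fun x h1 h2 => ?_⟩
      rcases lt_trichotomy x a with hx | rfl | hx
      · exact hsgn x h1 hx
      · simp [hea]
      · rw [← mul_assoc, mul_comm (e x)]
        exact mul_nonneg (h x hx h2) (hprod x hx).le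
    · refine ⟨insert a S, Finset.insert_subset_insert _ hSZ, -σ, neg_ne_zero.2 hσ,
        fun x h1 h2 => ?_⟩
      rw [Finset.prod_insert haS]
      rcases lt_trichotomy x a with hx | rfl | hx
      · nlinarith [hsgn x h1 hx]
      · simp [hea]
      · have h3 := mul_nonneg (mul_nonneg (neg_nonneg.2 (h x hx h2)) (hprod x hx).le)
          (sub_nonneg.2 hx.le)
        linarith

theorem exists_improvement {f : ℝ → ℝ} {p q s u v : ℝ[X]} {k : ℕ} {E : ℝ}
    (hp : p.natDegree ≤ k) (hq : q.natDegree ≤ k) (hu : u.natDegree ≤ k) (hv : v.natDegree ≤ k)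
    (hq0 : ∀ x ∈ Set.Icc (0:ℝ) 1, q.eval x ≠ 0) (huv : u * q + v * p = s) (hE : 0 < E)
    (he : ∀ x ∈ Set.Icc (0:ℝ) 1, |p.eval x / q.eval x - f x| ≤ E)
    (hs : ∀ x ∈ Set.Icc (0:ℝ) 1, 0 ≤ (p.eval x / q.eval x - f x) * s.eval x)
    (hs0 : ∀ x ∈ Set.Icc (0:ℝ) 1, s.eval x = 0 → p.eval x / q.eval x - f x = 0) :
    ∃ P Q : ℝ[X], P.natDegree ≤ k ∧ Q.natDegree ≤ k ∧
      (∀ x ∈ Set.Icc (0:ℝ) 1, Q.eval x ≠ 0) ∧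
      ∀ x ∈ Set.Icc (0:ℝ) 1, |P.eval x / Q.eval x - f x| < E := by
  obtain ⟨x₀, hx₀, hmin⟩ := isCompact_Icc.exists_isMinOn (Set.nonempty_Icc.2 zero_le_one)
    (q * q).continuous.continuousOn
  obtain ⟨M, hM⟩ := isCompact_Icc.exists_bound_of_continuousOn (s := Set.Icc (0:ℝ) 1)
    s.continuous.continuousOn
  obtain ⟨V, hV⟩ := isCompact_Icc.exists_bound_of_continuousOn (s := Set.Icc (0:ℝ) 1)
    (q * v).continuous.continuousOn
  set m := (q * q).eval x₀ with hm
  have hm0 : 0 < m := by rw [hm, eval_mul]; exact mul_self_pos.2 (hq0 _ hx₀)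
  have hM0 : 0 ≤ M := (norm_nonneg _).trans (hM _ hx₀)
  have hV0 : 0 ≤ V := (norm_nonneg _).trans (hV _ hx₀)
  obtain ⟨ε, hε, hεV, hεM⟩ : ∃ ε : ℝ, 0 < ε ∧ ε * V ≤ m / 2 ∧ ε * M < E * (m / 2) := by
    refine ⟨min (m / 2 / (V + 1)) (E * (m / 2) / (M + 1)), by positivity, ?_, ?_⟩
    · calc _ ≤ m / 2 / (V + 1) * V := by gcongr; exact min_le_left _ _
        _ ≤ m / 2 / (V + 1) * (V + 1) := by gcongr; linarith
        _ = m / 2 := by field_simp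
    · calc _ ≤ E * (m / 2) / (M + 1) * M := by gcongr; exact min_le_right _ _
        _ < E * (m / 2) / (M + 1) * (M + 1) := by gcongr; linarith
        _ = E * (m / 2) := by field_simp
  have hD : ∀ x ∈ Set.Icc (0:ℝ) 1, m / 2 ≤ q.eval x * (q + C ε * v).eval x := by
    intro x hx
    have h1 : m ≤ (q * q).eval x := hmin hx
    have h2 := (abs_le.1 (hV x hx)).1
    simp only [eval_mul, eval_add, eval_C] at h1 h2 ⊢
    nlinarith
  have hQ0 : ∀ x ∈ Set.Icc (0:ℝ) 1, (q + C ε * v).eval x ≠ 0 := fun x hx h => by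
    have := hD x hx
    rw [h] at this
    linarith
  refine ⟨p - C ε * u, q + C ε * v, ?_, ?_, hQ0, fun x hx => ?_⟩
  · exact (natDegree_sub_le_of_le hp ((natDegree_C_mul_le _ _).trans hu)).trans (max_self _).le
  · exact (natDegree_add_le_of_le hq ((natDegree_C_mul_le _ _).trans hv)).trans (max_self _).le
  have hDx := hD x hx
  have hDpos : 0 < q.eval x * (q + C ε * v).eval x := by linarith
  set D := q.eval x * (q + C ε * v).eval x with hDdef
  set e := p.eval x / q.eval x - f x with hedef
  have hdiff : (p - C ε * u).eval x / (q + C ε * v).eval x - f x = e - ε * s.eval x / D := by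
    have h1 := hq0 x hx
    have h2 := hQ0 x hx
    rw [hedef, hDdef, ← huv]
    simp only [eval_mul, eval_add, eval_sub, eval_C] at h2 ⊢
    field_simp
    ring
  rw [hdiff]
  have hex := abs_le.1 (he x hx)
  have hsx := hs x hx
  have hMx := abs_le.1 (hM x hx)
  have ht : |ε * s.eval x / D| < E := by
    rw [abs_div, abs_mul, abs_of_pos hε, abs_of_pos hDpos, div_lt_iff₀ hDpos]
    have h3 : |s.eval x| ≤ M := hM x hx
    nlinarith
  have ht' := abs_lt.1 ht
  rcases lt_trichotomy (s.eval x) 0 with h | h | h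
  · have h4 : ε * s.eval x / D < 0 := div_neg_of_neg_of_pos (mul_neg_of_pos_of_neg hε h) hDpos
    have h5 : e ≤ 0 := by
      by_contra! h6
      nlinarith
    rw [abs_lt]
    constructor <;> linarith
  · have he0 : e = 0 := hs0 x hx h
    rw [h, he0]
    simpa using hE
  · have h4 : 0 < ε * s.eval x / D := by positivity
    have h5 : 0 ≤ e := by
      by_contra! h6
      nlinarith
    rw [abs_lt]
    constructor <;> linarith

theorem eq_zero_of_eval_eq_zero_on_Icc {P : ℝ[X]}
    (h : ∀ x ∈ Set.Icc (0:ℝ) 1, P.eval x = 0) : P = 0 :=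
  P.eq_zero_of_infinite_isRoot ((Set.Icc_infinite one_pos).mono fun x hx => h x hx)

/-- A compactness argument: nearly optimal quotients converge, in coefficients, to a pair
`(P, Q)` satisfying the optimal inequality with the denominator cleared. -/
theorem exists_minimizing_pair {f : ℝ → ℝ} {k : ℕ} {E : ℝ}
    (h : ∀ δ > 0, ∃ P Q : ℝ[X], P.natDegree ≤ k ∧ Q.natDegree ≤ k ∧ Q ≠ 0 ∧
      ∀ x ∈ Set.Icc (0:ℝ) 1, |P.eval x - f x * Q.eval x| ≤ (E + δ) * |Q.eval x|) :
    ∃ P Q : ℝ[X], P.natDegree ≤ k ∧ Q.natDegree ≤ k ∧ Q ≠ 0 ∧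
      ∀ x ∈ Set.Icc (0:ℝ) 1, |P.eval x - f x * Q.eval x| ≤ E * |Q.eval x| := by
  let poly : (Fin (k + 1) → ℝ) → ℝ[X] := fun c => ∑ i, C (c i) * X ^ (i : ℕ)
  have heval : ∀ c x, (poly c).eval x = ∑ i, c i * x ^ (i : ℕ) := fun c x => by
    simp [poly, eval_finsetSum]
  have hcont : ∀ x, Continuous fun c => (poly c).eval x := fun x => by
    simp only [heval]; fun_prop
  have hsmul : ∀ (r : ℝ) c x, (poly (r • c)).eval x = r * (poly c).eval x := fun r c x => by
    simp only [heval, Finset.mul_sum, Pi.smul_apply, smul_eq_mul, mul_assoc]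
  have hdeg : ∀ c, (poly c).natDegree ≤ k := fun c =>
    natDegree_sum_le_of_forall_le _ _ fun i _ =>
      (natDegree_C_mul_X_pow_le _ _).trans (Nat.lt_succ_iff.1 i.2)
  have hcoeff : ∀ P : ℝ[X], P.natDegree ≤ k → poly (fun i => P.coeff i) = P := fun P hP => by
    conv_rhs => rw [P.as_sum_range_C_mul_X_pow' (Nat.lt_succ_of_le hP)]
    exact Fin.sum_univ_eq_sum_range (fun i => C (P.coeff i) * X ^ i) (k + 1)
  have hzero : ∀ c, poly c = 0 → c = 0 := fun c hc => by
    funext i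
    have h1 : (poly c).coeff (i : ℕ) = c i := by
      simp only [poly, finsetSum_coeff, coeff_C_mul, coeff_X_pow]
      rw [Finset.sum_eq_single i]
      · simp
      · intro j _ hji
        rw [if_neg fun hh => hji (Fin.ext hh.symm), mul_zero]
      · simp
    rw [← h1, hc]
    simp
  let A : ℕ → Set ((Fin (k + 1) → ℝ) × (Fin (k + 1) → ℝ)) := fun n =>
    Metric.sphere 0 1 ∩ ⋂ x ∈ Set.Icc (0:ℝ) 1,
      {c | |(poly c.1).eval x - f x * (poly c.2).eval x| ≤
        (E + 1 / ((n : ℝ) + 1)) * |(poly c.2).eval x|}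
  have hclosed : ∀ n, IsClosed (A n) := fun n =>
    Metric.isClosed_sphere.inter <| isClosed_biInter fun x _ =>
      isClosed_le
        (((hcont x).comp continuous_fst).sub
          (continuous_const.mul ((hcont x).comp continuous_snd))).abs
        (continuous_const.mul ((hcont x).comp continuous_snd).abs)
  have hne : ∀ n, (A n).Nonempty := by
    intro n
    obtain ⟨P, Q, hP, hQ, hQ0, hPQ⟩ := h (1 / ((n : ℝ) + 1)) (by positivity)
    set c : (Fin (k + 1) → ℝ) × (Fin (k + 1) → ℝ) := (fun i => P.coeff i, fun i => Q.coeff i)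
      with hc
    have hc0 : c ≠ 0 := by
      intro h0
      apply hQ0
      have h2 : (fun i : Fin (k + 1) => Q.coeff i) = 0 := congrArg Prod.snd h0
      rw [← hcoeff Q hQ, h2]
      simp [poly]
    refine ⟨‖c‖⁻¹ • c, ?_, ?_⟩
    · rw [mem_sphere_zero_iff_norm, norm_smul, norm_inv, norm_norm,
        inv_mul_cancel₀ (norm_ne_zero_iff.2 hc0)]
    · rw [Set.mem_iInter₂]
      intro x hx
      rw [Set.mem_ofPred_eq, Prod.smul_fst, Prod.smul_snd, hsmul, hsmul, hc]
      simp only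
      rw [hcoeff P hP, hcoeff Q hQ, abs_mul, mul_left_comm (f x), ← mul_sub, abs_mul,
        mul_left_comm]
      exact mul_le_mul_of_nonneg_left (hPQ x hx) (abs_nonneg _)
  obtain ⟨c, hc⟩ := IsCompact.nonempty_iInter_of_sequence_nonempty_isCompact_isClosed A
    (fun n => Set.inter_subset_inter_right _ <| Set.iInter₂_mono fun x _ c hc => by
      rw [Set.mem_ofPred_eq] at hc ⊢
      refine le_trans hc (mul_le_mul_of_nonneg_right ?_ (abs_nonneg _))
      gcongr
      simp)
    hne ((isCompact_sphere _ _).inter_right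
      (isClosed_biInter fun x _ =>
      isClosed_le
        (((hcont x).comp continuous_fst).sub
          (continuous_const.mul ((hcont x).comp continuous_snd))).abs
        (continuous_const.mul ((hcont x).comp continuous_snd).abs))) hclosed
  rw [Set.mem_iInter] at hc
  have hineq : ∀ x ∈ Set.Icc (0:ℝ) 1,
      |(poly c.1).eval x - f x * (poly c.2).eval x| ≤ E * |(poly c.2).eval x| := by
    intro x hx
    have hlim : Filter.Tendsto (fun n : ℕ => (E + 1 / ((n : ℝ) + 1)) * |(poly c.2).eval x|)
        Filter.atTop (nhds ((E + 0) * |(poly c.2).eval x|)) :=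
      (tendsto_const_nhds.add tendsto_one_div_add_atTop_nhds_zero_nat).mul_const _
    rw [add_zero] at hlim
    exact ge_of_tendsto' hlim fun n => (Set.mem_iInter₂.1 (hc n).2 x hx)
  refine ⟨poly c.1, poly c.2, hdeg _, hdeg _, fun h0 => ?_, hineq⟩
  have hP0 : poly c.1 = 0 := eq_zero_of_eval_eq_zero_on_Icc fun x hx => by
    have := hineq x hx
    simpa [h0] using this
  have hc0 : c = 0 := Prod.ext (hzero _ hP0) (hzero _ h0)
  have := mem_sphere_zero_iff_norm.1 (hc 0).1
  rw [hc0] at this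
  simp at this

theorem exists_coprime_minimizing_pair {f : ℝ → ℝ} {k : ℕ} {E : ℝ}
    (hf : ContinuousOn f (Set.Icc 0 1)) {P Q : ℝ[X]} (hP : P.natDegree ≤ k)
    (hQ : Q.natDegree ≤ k) (hQ0 : Q ≠ 0)
    (h : ∀ x ∈ Set.Icc (0:ℝ) 1, |P.eval x - f x * Q.eval x| ≤ E * |Q.eval x|) :
    ∃ p q : ℝ[X], p.natDegree ≤ k ∧ q.natDegree ≤ k ∧ IsCoprime p q ∧
      (∀ x ∈ Set.Icc (0:ℝ) 1, q.eval x ≠ 0) ∧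
      ∀ x ∈ Set.Icc (0:ℝ) 1, |p.eval x / q.eval x - f x| ≤ E := by
  classical
  let _ := EuclideanDomain.gcdMonoid ℝ[X]
  obtain ⟨p, q, hp, hq, hu⟩ := extract_gcd P Q
  have hcop : IsCoprime p q := (gcd_isUnit_iff p q).1 hu
  set g := GCDMonoid.gcd P Q
  have hg0 : g ≠ 0 := by intro h0; rw [h0, zero_mul] at hq; exact hQ0 hq
  have hq0 : q ≠ 0 := by intro h0; rw [h0, mul_zero] at hq; exact hQ0 hq
  have hpdeg : p.natDegree ≤ k := by
    by_cases hp0 : p = 0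
    · simp [hp0]
    · rw [hp, natDegree_mul hg0 hp0] at hP; omega
  have hqdeg : q.natDegree ≤ k := by rw [hq, natDegree_mul hg0 hq0] at hQ; omega
  have hoff : ∀ x ∈ Set.Icc (0:ℝ) 1, g.eval x ≠ 0 →
      |p.eval x - f x * q.eval x| ≤ E * |q.eval x| := by
    intro x hx hgx
    have h1 := h x hx
    rw [hp, hq, eval_mul, eval_mul, mul_left_comm, ← mul_sub, abs_mul, abs_mul,
      mul_left_comm] at h1
    exact le_of_mul_le_mul_left h1 (abs_pos.2 hgx)
  have hall : ∀ x ∈ Set.Icc (0:ℝ) 1, |p.eval x - f x * q.eval x| ≤ E * |q.eval x| := by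
    have hdense : Set.Icc (0:ℝ) 1 ⊆ closure (Set.Ioo (0:ℝ) 1 \ (g.roots.toFinset : Set ℝ)) := by
      rw [← closure_Ioo (zero_ne_one' ℝ)]
      refine closure_minimal ?_ isClosed_closure
      have hd : Dense ((g.roots.toFinset : Set ℝ)ᶜ) :=
        g.roots.toFinset.countable_toSet.dense_compl ℝ
      exact hd.open_subset_closure_inter isOpen_Ioo
    intro x hx
    have hsub : Set.Ioo (0:ℝ) 1 \ (g.roots.toFinset : Set ℝ) ⊆ Set.Icc 0 1 :=
      fun y hy => ⟨hy.1.1.le, hy.1.2.le⟩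
    have hcl : ContinuousWithinAt (fun y => |p.eval y - f y * q.eval y|)
        (Set.Ioo (0:ℝ) 1 \ (g.roots.toFinset : Set ℝ)) x :=
      ((p.continuous.continuousOn.sub (hf.mul q.continuous.continuousOn)).abs x hx).mono hsub
    have hcr : ContinuousWithinAt (fun y => E * |q.eval y|)
        (Set.Ioo (0:ℝ) 1 \ (g.roots.toFinset : Set ℝ)) x :=
      (continuous_const.mul q.continuous.abs).continuousWithinAt
    refine ContinuousWithinAt.closure_le (hdense hx) hcl hcr fun y hy => ?_
    refine hoff y (hsub hy) fun hgy => hy.2 ?_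
    simp [hg0, hgy]
  have hqne : ∀ x ∈ Set.Icc (0:ℝ) 1, q.eval x ≠ 0 := by
    intro x hx hqx
    have h1 := hall x hx
    rw [hqx] at h1
    have hpx : p.eval x = 0 := by simpa using h1
    obtain ⟨a, b, hab⟩ := hcop
    have := congrArg (eval x) hab
    simp [hpx, hqx] at this
  refine ⟨p, q, hpdeg, hqdeg, hcop, hqne, fun x hx => ?_⟩
  have hpos := abs_pos.2 (hqne x hx)
  rw [div_sub' (hqne x hx), abs_div, div_le_iff₀ hpos, mul_comm (q.eval x)]
  exact hall x hx

theorem bddAbove_range_abs_sub_rpow {α : ℝ} (hα : 0 < α) {P Q : ℝ[X]}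
    (hQ : ∀ z ∈ Set.Icc (0:ℝ) 1, Q.eval z ≠ 0) :
    BddAbove (Set.range fun z : Set.Icc (0:ℝ) 1 =>
      |P.eval (z : ℝ) / Q.eval (z : ℝ) - (z : ℝ) ^ α|) := by
  have hcont : ContinuousOn (fun z : ℝ => |P.eval z / Q.eval z - z ^ α|) (Set.Icc 0 1) :=
    ((P.continuous.continuousOn.div Q.continuous.continuousOn hQ).sub
      (Real.continuous_rpow_const hα.le).continuousOn).abs
  have := isCompact_Icc.bddAbove_image hcont
  rwa [Set.image_eq_range] at this

theorem buraError_zero_le {α : ℝ} {k : ℕ} {P Q : ℝ[X]} (hP : P.natDegree ≤ k)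
    (hQ : Q.natDegree ≤ k) (hQ0 : ∀ z ∈ Set.Icc (0:ℝ) 1, Q.eval z ≠ 0) :
    buraError 0 α k ≤ ⨆ z : Set.Icc (0:ℝ) 1,
      |P.eval (z : ℝ) / Q.eval (z : ℝ) - (z : ℝ) ^ α| := by
  refine csInf_le ⟨0, ?_⟩ ⟨P, Q, hP, hQ, hQ0, by simp⟩
  rintro e ⟨P, Q, -, -, -, rfl⟩
  exact Real.iSup_nonneg fun _ => abs_nonneg _

/-- The best approximation error is attained by a quotient of coprime polynomials. -/
theorem exists_coprime_best_approximation {α : ℝ} (hα : 0 < α) (k : ℕ) :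
    ∃ p q : ℝ[X], p.natDegree ≤ k ∧ q.natDegree ≤ k ∧ IsCoprime p q ∧
      (∀ x ∈ Set.Icc (0:ℝ) 1, q.eval x ≠ 0) ∧
      ∀ x ∈ Set.Icc (0:ℝ) 1, |p.eval x / q.eval x - x ^ α| ≤ buraError 0 α k := by
  obtain ⟨P, Q, hP, hQ, hQ0, hPQ⟩ := exists_minimizing_pair (f := fun x : ℝ => x ^ α) (k := k)
    (E := buraError 0 α k) (by
      intro δ hδ
      obtain ⟨e, ⟨P, Q, hP, hQ, hQ0, he⟩, hlt⟩ := exists_lt_of_csInf_lt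
        (⟨_, 0, 1, by simp, by simp, by simp, rfl⟩ : Set.Nonempty { e : ℝ | ∃ P Q : ℝ[X],
          P.natDegree ≤ k ∧ Q.natDegree ≤ k ∧ (∀ z ∈ Set.Icc (0:ℝ) 1, Q.eval z ≠ 0) ∧
          e = ⨆ z : Set.Icc (0:ℝ) 1,
            |P.eval (z : ℝ) / Q.eval (z : ℝ) - (z : ℝ) ^ α / (1 + 0 * (z : ℝ) ^ α)| })
        (lt_add_of_pos_right (buraError 0 α k) hδ)
      simp only [zero_mul, add_zero, div_one] at he
      refine ⟨P, Q, hP, hQ, ?_, fun x hx => ?_⟩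
      · rintro rfl
        exact hQ0 0 (by simp) (by simp)
      · have h1 : |P.eval x / Q.eval x - x ^ α| ≤ buraError 0 α k + δ := by
          refine le_trans ?_ hlt.le
          rw [he]
          exact le_ciSup (bddAbove_range_abs_sub_rpow hα hQ0) (⟨x, hx⟩ : Set.Icc (0:ℝ) 1)
        have h2 := abs_pos.2 (hQ0 x hx)
        rw [div_sub' (hQ0 x hx), abs_div, div_le_iff₀ h2, mul_comm (Q.eval x)] at h1
        exact h1)
  exact exists_coprime_minimizing_pair (Real.continuous_rpow_const hα.le).continuousOn
    hP hQ hQ0 hPQ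

/-- A best approximation interpolates `z^α` at `2k+1` points of `(0,1)`. -/
theorem exists_interpolation_nodes {α : ℝ} (hα : α ∈ Set.Ioo (0:ℝ) 1) {k : ℕ} {p q : ℝ[X]}
    (hp : p.natDegree ≤ k) (hq : q.natDegree ≤ k) (hcop : IsCoprime p q)
    (hq0 : ∀ x ∈ Set.Icc (0:ℝ) 1, q.eval x ≠ 0)
    (he : ∀ x ∈ Set.Icc (0:ℝ) 1, |p.eval x / q.eval x - x ^ α| ≤ buraError 0 α k) :
    ∃ S : Finset ℝ, (∀ z ∈ S, 0 < z) ∧ #S = 2 * k + 1 ∧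
      ∀ z ∈ S, p.eval z = z ^ α * q.eval z := by
  have hqne : q ≠ 0 := by
    rintro rfl
    exact hq0 0 (by simp) (by simp)
  set n := max p.natDegree q.natDegree with hn
  have hnk : n ≤ k := max_le hp hq
  set e : ℝ → ℝ := fun x => p.eval x / q.eval x - x ^ α with hedef
  have hiff : ∀ x ∈ Set.Icc (0:ℝ) 1, e x = 0 → p.eval x = x ^ α * q.eval x := by
    intro x hx h
    exact (div_eq_iff (hq0 x hx)).1 (sub_eq_zero.1 h)
  have hbound : ∀ T : Finset ℝ, (∀ z ∈ T, 0 < z ∧ z < 1 ∧ e z = 0) → #T ≤ 2 * n + 1 :=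
    fun T hT => card_le_of_interpolates hα (fun z hz => (hT z hz).1)
      (fun z hz => hiff z ⟨(hT z hz).1.le, (hT z hz).2.1.le⟩ (hT z hz).2.2)
      (le_max_left _ _) (le_max_right _ _) hqne
  have hfin : Set.Finite {x : ℝ | 0 < x ∧ x < 1 ∧ e x = 0} := by
    by_contra hinf
    obtain ⟨T, hT, hTc⟩ := Set.Infinite.exists_subset_card_eq hinf (2 * n + 2)
    have := hbound T fun z hz => hT hz
    omega
  have hE : 0 < buraError 0 α k := by
    by_contra! hE
    refine (Set.Ioo_infinite (zero_lt_one' ℝ)) (hfin.subset fun x hx => ⟨hx.1, hx.2, ?_⟩)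
    exact abs_nonpos_iff.1 ((he x ⟨hx.1.le, hx.2.le⟩).trans hE)
  have hecont : ContinuousOn e (Set.Icc 0 1) :=
    (p.continuous.continuousOn.div q.continuous.continuousOn hq0).sub
      (Real.continuous_rpow_const hα.1.le).continuousOn
  obtain ⟨S, hSZ, σ, hσ, hsgn⟩ := exists_subset_zeros_mul_prod_nonneg hfin.toFinset 1 hecont
    (fun z hz => by rw [Set.Finite.mem_toFinset] at hz; exact ⟨hz.1, hz.2.1⟩)
    (fun x h1 h2 h3 => by rw [Set.Finite.mem_toFinset]; exact ⟨h1, h2, h3⟩)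
    (fun z hz => by rw [Set.Finite.mem_toFinset] at hz; exact hz.2.2)
  have hS : ∀ z ∈ S, 0 < z ∧ z < 1 ∧ e z = 0 := fun z hz => by
    have := hSZ hz
    rw [Set.Finite.mem_toFinset] at this
    exact this
  have hScard : 2 * k + 1 ≤ #S := by
    by_contra! hlt
    have hle := hbound S hS
    have hdeg : (C σ * ∏ s ∈ S, (X - C s)).natDegree ≤ n + k := by
      refine (natDegree_C_mul_le _ _).trans ?_
      rw [natDegree_prod_of_monic _ _ fun i _ => monic_X_sub_C _]
      simp only [natDegree_X_sub_C, Finset.sum_const, smul_eq_mul, mul_one]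
      omega
    obtain ⟨u, v, hu, hv, huv⟩ := exists_bezout_natDegree_le_of_max hcop hqne hp hq hdeg
    have hseval : ∀ x, (C σ * ∏ s ∈ S, (X - C s)).eval x = σ * ∏ s ∈ S, (x - s) := fun x => by
      simp [eval_prod]
    have hnonneg : ∀ x ∈ Set.Icc (0:ℝ) 1, 0 ≤ e x * (C σ * ∏ s ∈ S, (X - C s)).eval x := by
      intro x hx
      have hx' := hx
      rw [← closure_Ioo (zero_ne_one' ℝ)] at hx'
      have hc : ContinuousWithinAt (fun y => e y * (C σ * ∏ s ∈ S, (X - C s)).eval y)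
          (Set.Ioo 0 1) x :=
        ((hecont.mul (C σ * ∏ s ∈ S, (X - C s)).continuous.continuousOn) x hx).mono
          Set.Ioo_subset_Icc_self
      have h0 : ContinuousWithinAt (fun _ : ℝ => (0:ℝ)) (Set.Ioo 0 1) x :=
        continuousWithinAt_const
      refine ContinuousWithinAt.closure_le hx' h0 hc fun y hy => ?_
      have := hsgn y hy.1 hy.2
      rwa [← hseval] at this
    obtain ⟨P, Q, hP, hQ, hQ0, hPQ⟩ := exists_improvement (f := fun x : ℝ => x ^ α) hp hq hu hv
      hq0 huv hE he hnonneg (fun x hx h => by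
        rw [hseval, mul_eq_zero, Finset.prod_eq_zero_iff] at h
        obtain ⟨s, hs, hxs⟩ := h.resolve_left hσ
        rw [sub_eq_zero.1 hxs]
        exact (hS s hs).2.2)
    have hcont : ContinuousOn (fun z : ℝ => |P.eval z / Q.eval z - z ^ α|) (Set.Icc 0 1) :=
      ((P.continuous.continuousOn.div Q.continuous.continuousOn hQ0).sub
        (Real.continuous_rpow_const hα.1.le).continuousOn).abs
    obtain ⟨x₀, hx₀, hmax⟩ := isCompact_Icc.exists_isMaxOn
      (Set.nonempty_Icc.2 (zero_le_one' ℝ)) hcont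
    have h1 := buraError_zero_le (α := α) hP hQ hQ0
    have : Nonempty (Set.Icc (0:ℝ) 1) := ⟨⟨0, by simp⟩⟩
    have h2 : (⨆ z : Set.Icc (0:ℝ) 1, |P.eval (z : ℝ) / Q.eval (z : ℝ) - (z : ℝ) ^ α|) ≤
      |P.eval x₀ / Q.eval x₀ - x₀ ^ α| := ciSup_le fun z => hmax z.2
    exact (h1.trans h2).not_gt (hPQ x₀ hx₀)
  obtain ⟨T, hTS, hT⟩ := Finset.exists_subset_card_eq hScard
  exact ⟨T, fun z hz => (hS z (hTS hz)).1, hT, fun z hz =>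
    hiff z ⟨(hS z (hTS hz)).1.le, (hS z (hTS hz)).2.1.le⟩ (hS z (hTS hz)).2.2⟩

/-- Existence and structure of the best uniform rational approximation of `z^α` on `[0,1]`:
there are `b > 0` and real interlacing negative zeros `ζᵢ` and poles `dᵢ`,
`0 > ζ₁ > d₁ > ζ₂ > d₂ > ⋯ > ζ_k > d_k`, such that
`r(z) = b ∏ᵢ (z - ζᵢ)/(z - dᵢ)` attains the BURA error `E_{α,k}`. -/
theorem bura_exists_interlacing (α : ℝ) (hα : α ∈ Set.Ioo (0:ℝ) 1) (k : ℕ) (hk : 1 ≤ k) :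
    ∃ (b : ℝ) (ζ d : Fin k → ℝ), 0 < b ∧
      ζ ⟨0, hk⟩ < 0 ∧
      (∀ i : Fin k, d i < ζ i) ∧
      (∀ i j : Fin k, (i : ℕ) + 1 = (j : ℕ) → ζ j < d i) ∧
      (⨆ z : Set.Icc (0:ℝ) 1,
          |b * ∏ i, ((z : ℝ) - ζ i) / ((z : ℝ) - d i) - (z : ℝ) ^ α|) = buraError 0 α k := by
  obtain ⟨p, q, hp, hq, hcop, hq0, he⟩ := exists_coprime_best_approximation hα.1 k
  obtain ⟨S, hS, hcard, hpq⟩ := exists_interpolation_nodes hα hp hq hcop hq0 he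
  have hqne : q ≠ 0 := by
    rintro rfl
    exact hq0 0 (by simp) (by simp)
  obtain ⟨b, ζ, d, hb, h1, h2, h3, h4⟩ :=
    exists_interlacing_of_interpolates hα hk hS hcard hpq hp hq hqne
  refine ⟨b, ζ, d, hb, h1, h2, h3, ?_⟩
  simp only [h4]
  have : Nonempty (Set.Icc (0:ℝ) 1) := ⟨⟨0, by simp⟩⟩
  exact le_antisymm (ciSup_le fun z => he z z.2) (buraError_zero_le hp hq hq0)
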